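/- For every even integer m ≥ 4, n_m ≤ (1/2)·(m-2)^{m-2}. -/

import Mathlib

/-- A graph `G` is `k`-choosable if for every assignment of lists of `k` colors
to the vertices there is a proper coloring choosing each vertex's color from its list. -/
def Choosable {V : Type*} (G : SimpleGraph V) (k : ℕ) : Prop :=
  ∀ L : V → Finset ℕ, (∀ v, (L v).card = k) →
    ∃ c : V → ℕ, (∀ v, c v ∈ L v) ∧ ∀ u w, G.Adj u w → c u ≠ c w

/-- The choice number of `G` is the least `k` such that `G` is `k`-choosable. -/
noncomputable def choiceNumber {V : Type*} (G : SimpleGraph V) : ℕ :=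
  sInf {k | Choosable G k}

/-- `nm m` is the smallest integer `n` such that `ch (K_{m,n}) = m - 1`. -/
noncomputable def nm (m : ℕ) : ℕ :=
  sInf {n | choiceNumber (completeBipartiteGraph (Fin m) (Fin n)) = m - 1}


/-- A graph that is `k`-choosable is `l`-choosable for every `l ≥ k`. -/
theorem Choosable.mono {V : Type*} {G : SimpleGraph V} {k l : ℕ} (h : Choosable G k)
    (hkl : k ≤ l) : Choosable G l := by
  intro L hL
  have hsub : ∀ v, ∃ s ⊆ L v, s.card = k := fun v =>
    Finset.exists_subset_card_eq (by rw [hL v]; exact hkl)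
  choose L' hL' hcard using hsub
  obtain ⟨c, hc, hadj⟩ := h L' hcard
  exact ⟨c, fun v => hL' v (hc v), hadj⟩

/-- The choice number is `k + 1` when the graph is `(k + 1)`-choosable but not `k`-choosable. -/
theorem choiceNumber_eq_succ {V : Type*} {G : SimpleGraph V} {k : ℕ}
    (h : Choosable G (k + 1)) (h' : ¬ Choosable G k) : choiceNumber G = k + 1 := by
  refine le_antisymm (Nat.sInf_le h) (le_csInf ⟨_, h⟩ fun l hl => ?_)
  by_contra! hlt
  exact h' (Choosable.mono hl (by omega))

/-- An edgeless complete bipartite graph is `1`-choosable. -/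
theorem choosable_completeBipartiteGraph_zero (m : ℕ) :
    Choosable (completeBipartiteGraph (Fin m) (Fin 0)) 1 := by
  intro L hL
  have hne : ∀ v, ∃ a, a ∈ L v := fun v =>
    Finset.card_pos.mp (by rw [hL v]; exact one_pos)
  choose c hc using hne
  refine ⟨c, hc, ?_⟩
  rintro (u | u) (w | w) h
  · simp at h
  · exact w.elim0
  · exact u.elim0
  · exact u.elim0

/-- Adding a vertex to one side raises the required list size by at most one. -/
theorem Choosable.completeBipartiteGraph_succ {m n k : ℕ}
    (h : Choosable (completeBipartiteGraph (Fin m) (Fin n)) k) :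
    Choosable (completeBipartiteGraph (Fin m) (Fin (n + 1))) (k + 1) := by
  intro L hL
  obtain ⟨a, ha⟩ : (L (.inr (Fin.last n))).Nonempty :=
    Finset.card_pos.mp (by rw [hL]; omega)
  have hleft : ∀ i : Fin m, ∃ s ⊆ (L (.inl i)).erase a, s.card = k := fun i =>
    Finset.exists_subset_card_eq (by
      have := Finset.pred_card_le_card_erase (s := L (.inl i)) (a := a)
      rw [hL] at this
      exact this)
  have hright : ∀ j : Fin n, ∃ s ⊆ L (.inr j.castSucc), s.card = k := fun j =>
    Finset.exists_subset_card_eq (by rw [hL]; omega)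
  choose S hS hScard using hleft
  choose T hT hTcard using hright
  obtain ⟨c, hc, hadj⟩ := h (Sum.elim S T) (by rintro (i | j) <;> simp [hScard, hTcard])
  have hcl : ∀ i, c (.inl i) ≠ a ∧ c (.inl i) ∈ L (.inl i) := fun i =>
    Finset.mem_erase.mp (hS i (hc (.inl i)))
  let r : Fin (n + 1) → ℕ := Fin.lastCases a (fun j => c (.inr j))
  have hne : ∀ i j, c (.inl i) ≠ r j := by
    intro i j
    induction j using Fin.lastCases with
    | last => simpa [r] using (hcl i).1
    | cast j => simpa [r] using hadj (.inl i) (.inr j) (by simp)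
  refine ⟨Sum.elim (fun i => c (.inl i)) r, ?_, ?_⟩
  · rintro (i | j)
    · exact (hcl i).2
    · induction j using Fin.lastCases with
      | last => simpa [r] using ha
      | cast j => simpa [r] using hT j (hc (.inr j))
  · rintro (u | u) (w | w) huw
    · simp at huw
    · exact hne u w
    · exact (hne w u).symm
    · simp at huw

/-- If `K_{m,n}` is not `(m - 2)`-choosable, then `n_m ≤ n`. -/
theorem nm_le_of_not_choosable {d n : ℕ} (hd : 1 ≤ d)
    (h : ¬ Choosable (completeBipartiteGraph (Fin (d + 2)) (Fin n)) d) : nm (d + 2) ≤ n := by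
  classical
  have hex : ∃ n, ¬ Choosable (completeBipartiteGraph (Fin (d + 2)) (Fin n)) d := ⟨n, h⟩
  refine le_trans (Nat.sInf_le ?_) (Nat.find_min' hex h)
  have hspec := Nat.find_spec hex
  cases hN : Nat.find hex with
  | zero =>
    rw [hN] at hspec
    exact absurd ((choosable_completeBipartiteGraph_zero _).mono hd) hspec
  | succ N =>
    have hprev := not_not.mp (Nat.find_min hex (m := N) (by omega))
    rw [hN] at hspec
    exact choiceNumber_eq_succ hprev.completeBipartiteGraph_succ hspec

/-- The colors `(i, j)` with `j` in `s`, encoded as natural numbers. -/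
def pairRow (i : ℕ) (s : Finset ℕ) : Finset ℕ := s.image (Nat.pair i)

theorem mem_pairRow {i x : ℕ} {s : Finset ℕ} : x ∈ pairRow i s ↔ ∃ j ∈ s, Nat.pair i j = x := by
  simp [pairRow]

theorem card_pairRow (i : ℕ) (s : Finset ℕ) : (pairRow i s).card = s.card :=
  Finset.card_image_of_injective _ fun _ _ hab => (Nat.pair_eq_pair.mp hab).2

theorem card_pairRow_union (s : Finset ℕ) :
    (pairRow 0 s ∪ pairRow 1 s).card = 2 * s.card := by
  rw [Finset.card_union_of_disjoint, card_pairRow, card_pairRow, two_mul]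
  rw [Finset.disjoint_left]
  intro x hx hx'
  obtain ⟨j, -, rfl⟩ := mem_pairRow.mp hx
  obtain ⟨l, -, hl⟩ := mem_pairRow.mp hx'
  exact absurd (Nat.pair_eq_pair.mp hl).1 one_ne_zero

/-- Lists for the side of size `2h + 2`: the `2h` rows of a square grid, followed by
the left halves and the right halves of the first two rows. -/
def gridList (h : ℕ) (i : Fin (2 * h + 2)) : Finset ℕ :=
  if i.1 < 2 * h then pairRow i (Finset.range (2 * h))
  else if i.1 = 2 * h then
    pairRow 0 (Finset.range h) ∪ pairRow 1 (Finset.range h)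
  else pairRow 0 (Finset.Ico h (2 * h)) ∪ pairRow 1 (Finset.Ico h (2 * h))

theorem card_gridList (h : ℕ) (i : Fin (2 * h + 2)) : (gridList h i).card = 2 * h := by
  unfold gridList
  split_ifs
  · simp [card_pairRow]
  · simp [card_pairRow_union]
  · rw [card_pairRow_union, Nat.card_Ico]
    omega

/-- Choices of one point per row of a grid of side `2h` whose points in the first two rows lie in
different halves. -/
abbrev SplitTransversal (h : ℕ) (hh : 0 < h) : Type :=
  {f : Fin (2 * h) → Fin (2 * h) //
    ¬ ((f ⟨0, by omega⟩).1 < h ↔ (f ⟨1, by omega⟩).1 < h)}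

theorem two_mul_card_splitTransversal (h : ℕ) (hh : 0 < h) :
    2 * Fintype.card (SplitTransversal h hh) = (2 * h) ^ (2 * h) := by
  let φ : (Fin (2 * h) → Fin (2 * h)) → (Fin (2 * h) → Fin (2 * h)) := fun f =>
    Function.update f ⟨0, by omega⟩ (f ⟨0, by omega⟩).rev
  have hφ : Function.Involutive φ := by
    intro f
    simp [φ]
  let P : (Fin (2 * h) → Fin (2 * h)) → Prop := fun f =>
    ¬ ((f ⟨0, by omega⟩).1 < h ↔ (f ⟨1, by omega⟩).1 < h)
  have hP : ∀ f, P f ↔ ¬ P (φ f) := by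
    intro f
    have h10 : (⟨1, by omega⟩ : Fin (2 * h)) ≠ ⟨0, by omega⟩ := by simp
    simp only [P, φ, Function.update_self, Function.update_of_ne h10, Fin.val_rev]
    omega
  have key : Fintype.card {f // P f} = Fintype.card {f // ¬ P f} :=
    Fintype.card_congr (hφ.toPerm.subtypeEquiv hP)
  have hc := Fintype.card_subtype_compl P
  have hle := Fintype.card_subtype_le P
  have htot : Fintype.card (Fin (2 * h) → Fin (2 * h)) = (2 * h) ^ (2 * h) := by simp
  rw [htot] at hc hle
  rw [← key] at hc
  change 2 * Fintype.card {f // P f} = _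
  omega

/-- The list of colors on a transversal. -/
def transversalList {d : ℕ} (f : Fin d → Fin d) : Finset ℕ :=
  Finset.univ.image fun i : Fin d => Nat.pair i (f i)

theorem card_transversalList {d : ℕ} (f : Fin d → Fin d) : (transversalList f).card = d := by
  rw [transversalList, Finset.card_image_of_injective, Finset.card_univ, Fintype.card_fin]
  exact fun i j hij => Fin.ext (Nat.pair_eq_pair.mp hij).1

/-- The grid lists, set against the lists of all split transversals, admit no proper coloring. -/
theorem not_choosable_grid (h : ℕ) (hh : 0 < h) :
    ¬ Choosable (completeBipartiteGraph (Fin (2 * h + 2))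
      (Fin (Fintype.card (SplitTransversal h hh)))) (2 * h) := by
  intro hch
  let e := (Fintype.equivFin (SplitTransversal h hh)).symm
  obtain ⟨c, hc, hadj⟩ := hch (Sum.elim (gridList h) fun j => transversalList (e j).1) (by
    rintro (i | j)
    · exact card_gridList h i
    · exact card_transversalList _)
  have hsplit : ∀ g : Fin (2 * h) → Fin (2 * h),
      (∀ i : Fin (2 * h), ∃ v, c (.inl v) = Nat.pair i (g i)) →
      ((g ⟨0, by omega⟩).1 < h ↔ (g ⟨1, by omega⟩).1 < h) := by
    intro g hg
    by_contra hcon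
    have hmem := hc (.inr (e.symm ⟨g, hcon⟩))
    simp only [Sum.elim_inr, Equiv.apply_symm_apply, transversalList, Finset.mem_image,
      Finset.mem_univ, true_and] at hmem
    obtain ⟨i, hi⟩ := hmem
    obtain ⟨v, hv⟩ := hg i
    exact hadj (.inl v) (.inr _) (by simp) (hv.trans hi)
  have hrow : ∀ i : Fin (2 * h), ∃ j : Fin (2 * h),
      c (.inl (i.castLE (by omega))) = Nat.pair i j := by
    intro i
    have hmem := hc (.inl (i.castLE (by omega)))
    simp only [Sum.elim_inl, gridList, Fin.val_castLE, i.2, if_true] at hmem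
    obtain ⟨j, hj, hjc⟩ := mem_pairRow.mp hmem
    exact ⟨⟨j, Finset.mem_range.mp hj⟩, hjc.symm⟩
  choose f hf using hrow
  have hupd : ∀ (v : Fin (2 * h + 2)) (k j : Fin (2 * h)), c (.inl v) = Nat.pair k j →
      ((Function.update f k j ⟨0, by omega⟩).1 < h ↔
        (Function.update f k j ⟨1, by omega⟩).1 < h) := by
    intro v k j hv
    refine hsplit _ fun i => ?_
    by_cases hik : i = k
    · subst hik
      exact ⟨v, by rw [hv, Function.update_self]⟩
    · exact ⟨_, by rw [hf, Function.update_of_ne hik]⟩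
  have hiff := hsplit f fun i => ⟨_, hf i⟩
  have h01 : (⟨0, by omega⟩ : Fin (2 * h)) ≠ ⟨1, by omega⟩ := by simp
  have hhalf : ∀ (v : Fin (2 * h + 2)) (s : Finset ℕ), gridList h v = pairRow 0 s ∪ pairRow 1 s →
      (∀ j ∈ s, j < 2 * h) → ∃ j ∈ s, (j < h ↔ (f ⟨0, by omega⟩).1 < h) := by
    intro v s hv hs
    have hmem : c (.inl v) ∈ gridList h v := hc (.inl v)
    rw [hv, Finset.mem_union, mem_pairRow, mem_pairRow] at hmem
    obtain ⟨j, hj, hjc⟩ | ⟨j, hj, hjc⟩ := hmem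
    · have := hupd v ⟨0, by omega⟩ ⟨j, hs j hj⟩ hjc.symm
      rw [Function.update_self, Function.update_of_ne h01.symm] at this
      exact ⟨j, hj, this.trans hiff.symm⟩
    · have := hupd v ⟨1, by omega⟩ ⟨j, hs j hj⟩ hjc.symm
      rw [Function.update_self, Function.update_of_ne h01] at this
      exact ⟨j, hj, this.symm⟩
  obtain ⟨j, hj, hjf⟩ := hhalf ⟨2 * h, by omega⟩ (Finset.range h) (by simp [gridList])
    (fun j hj => by have := Finset.mem_range.mp hj; omega)
  obtain ⟨l, hl, hlf⟩ := hhalf ⟨2 * h + 1, by omega⟩ (Finset.Ico h (2 * h)) (by simp [gridList])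
    (fun j hj => (Finset.mem_Ico.mp hj).2)
  rw [Finset.mem_range] at hj
  rw [Finset.mem_Ico] at hl
  omega

/-- For every even integer `m ≥ 4`, `n_m ≤ (1/2) (m-2)^(m-2)`. -/
theorem nm_le_of_even (m : ℕ) (hm : 4 ≤ m) (heven : Even m) :
    (nm m : ℝ) ≤ (1 / 2) * ((m : ℝ) - 2) ^ (m - 2) := by
  obtain ⟨h, rfl⟩ : ∃ h, m = 2 * h + 2 := by
    obtain ⟨r, rfl⟩ := heven
    exact ⟨r - 1, by omega⟩
  have hh : 0 < h := by omega
  have hle := nm_le_of_not_choosable (by omega) (not_choosable_grid h hh)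
  have h2 : 2 * nm (2 * h + 2) ≤ (2 * h) ^ (2 * h) := by
    rw [← two_mul_card_splitTransversal h hh]
    omega
  have h3 : (2 : ℝ) * nm (2 * h + 2) ≤ (2 * h) ^ (2 * h) := by exact_mod_cast h2
  have h4 : ((2 * h + 2 : ℕ) : ℝ) - 2 = 2 * h := by push_cast; ring
  rw [h4, Nat.add_sub_cancel]
  linarith
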